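/- Let S be a nonempty finite set and let Λ_1, …, Λ_m ∈ ℕ^S be finitely many vectors such that each Λ_i has coordinate sum |Λ_i| ≥ 2 and every coordinate Λ_{i,ρ} ≤ 2. Let μ be the associated global Möbius function. Then for every y ∈ (ℕ_{>0})^S, the sum Σ_{d} μ(d), taken over those d ∈ (ℕ_{>0})^S such that d_ρ divides y_ρ for every ρ ∈ S (a finite set), equals 1 if for every prime p the vector (v_p(y_ρ))_{ρ∈S} lies in X, and equals 0 otherwise. -/

import Mathlib

/-- The global Möbius function `μ(d) = Π_p μloc((v_p(d_ρ))_ρ)`, a product over all primes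
with only finitely many factors different from `1`. -/
noncomputable def muGlob {S : Type*} (μloc : (S → ℕ) → ℤ) (d : S → ℕ) : ℤ :=
  ∏ᶠ (p : ℕ) (_ : p.Prime), μloc fun ρ => (d ρ).factorization p

theorem factorization_prod_attach_pow {P : Finset ℕ} (hP : ∀ p ∈ P, p.Prime) (e : P → ℕ) (q : ℕ) :
    (∏ p : P, (p : ℕ) ^ e p).factorization q = if h : q ∈ P then e ⟨q, h⟩ else 0 := by
  rw [Nat.factorization_prod fun (p : P) _ => pow_ne_zero _ (hP p p.2).ne_zero, Finsupp.finsetSum_apply]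
  have key : ∀ p : P, ((p : ℕ) ^ e p).factorization q = if (p : ℕ) = q then e p else 0 := by
    intro p
    rw [(hP p p.2).factorization_pow, Finsupp.single_apply]
  simp only [key]
  split_ifs with h
  · rw [Finset.sum_eq_single ⟨q, h⟩]
    · simp
    · intro b _ hb
      exact if_neg fun hbq => hb (Subtype.ext hbq)
    · simp
  · exact Finset.sum_eq_zero fun p _ => if_neg fun hp : (p : ℕ) = q => h (hp ▸ p.2)

theorem muGlob_eq_prod {S : Type*} {μloc : (S → ℕ) → ℤ} (h0 : μloc 0 = 1) {P : Finset ℕ}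
    (hP : ∀ p ∈ P, p.Prime) {d : S → ℕ} (hd : ∀ ρ, (d ρ).primeFactors ⊆ P) :
    muGlob μloc d = ∏ p : P, μloc fun ρ => (d ρ).factorization p := by
  rw [muGlob, Finset.prod_coe_sort P fun p => μloc fun ρ => (d ρ).factorization p]
  have hzero : ∀ p ∉ P, (μloc fun ρ => (d ρ).factorization p) = 1 := by
    intro p hp
    rw [← h0]
    congr 1
    funext ρ
    exact Finsupp.notMem_support_iff.mp fun h => hp (hd ρ h)
  rw [← finprod_mem_coe_finset]
  refine finprod_congr fun p => ?_
  by_cases hp : p ∈ P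
  · simp [hp, hP p hp]
  · simp [hp, hzero p hp]

theorem sum_piFinset_divisors_prod {S : Type*} [Fintype S] [DecidableEq S] (f : (S → ℕ) → ℤ)
    {P : Finset ℕ} (hP : ∀ p ∈ P, p.Prime) {y : S → ℕ} (hy : ∀ ρ, y ρ ≠ 0)
    (hyP : ∀ ρ, (y ρ).primeFactors ⊆ P) :
    ∑ d ∈ Fintype.piFinset (fun ρ => (y ρ).divisors),
        ∏ p : P, f (fun ρ => (d ρ).factorization p) =
      ∏ p : P, ∑ l ∈ Finset.Iic (fun ρ => (y ρ).factorization p), f l := by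
  have hne : ∀ e : P → ℕ, ∏ p : P, (p : ℕ) ^ e p ≠ 0 := fun e =>
    Finset.prod_ne_zero_iff.mpr fun p _ => pow_ne_zero _ (hP p p.2).ne_zero
  rw [Finset.prod_univ_sum]
  refine Finset.sum_nbij' (fun d p ρ => (d ρ).factorization p)
    (fun e ρ => ∏ p : P, (p : ℕ) ^ e p ρ) ?_ ?_ ?_ ?_ ?_
  · intro d hd
    simp only [Fintype.mem_piFinset, Nat.mem_divisors, Finset.mem_Iic] at hd ⊢
    exact fun p ρ => (Nat.factorization_le_iff_dvd
      (ne_zero_of_dvd_ne_zero (hy ρ) (hd ρ).1) (hy ρ)).mpr (hd ρ).1 p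
  · intro e he
    simp only [Fintype.mem_piFinset, Nat.mem_divisors, Finset.mem_Iic] at he ⊢
    refine fun ρ => ⟨(Nat.factorization_le_iff_dvd (hne _) (hy ρ)).mp fun q => ?_, hy ρ⟩
    rw [factorization_prod_attach_pow hP]
    split_ifs with h
    · exact he ⟨q, h⟩ ρ
    · exact Nat.zero_le _
  · intro d hd
    simp only [Fintype.mem_piFinset, Nat.mem_divisors] at hd
    funext ρ
    refine Nat.eq_of_factorization_eq (hne _) (ne_zero_of_dvd_ne_zero (hy ρ) (hd ρ).1) fun q => ?_
    rw [factorization_prod_attach_pow hP fun p => (d ρ).factorization p]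
    split_ifs with h
    · rfl
    · exact (Finsupp.notMem_support_iff.mp fun hq =>
        h (hyP ρ (Nat.primeFactors_mono (hd ρ).1 (hy ρ) hq))).symm
  · intro e _
    funext p ρ
    rw [factorization_prod_attach_pow hP fun p => e p ρ, dif_pos p.2]
  · intro d _
    rfl

/-- Möbius inversion: for a positive tuple `y`, the sum of `μ(d)` over the tuples `d`
with `d ρ ∣ y ρ` for all `ρ` equals `1` if `(v_p(y ρ))_ρ ∈ X` for every prime `p`,
and `0` otherwise. -/
theorem stmt15 (S : Type*) [Fintype S] [DecidableEq S] [Nonempty S]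
    (m : ℕ) (Λ : Fin m → S → ℕ)
    (hsum : ∀ i, 2 ≤ ∑ ρ, Λ i ρ) (hle : ∀ i ρ, Λ i ρ ≤ 2)
    (μloc : (S → ℕ) → ℤ)
    (hμ : ∀ τ : S → ℕ,
      (if ∀ i, ∃ ρ, τ ρ < Λ i ρ then (1 : ℤ) else 0) = ∑ l ∈ Finset.Iic τ, μloc l)
    (y : S → ℕ) (hy : ∀ ρ, 0 < y ρ) :
    ((∀ p : ℕ, p.Prime → ∀ i, ∃ ρ, (y ρ).factorization p < Λ i ρ) →
        ∑ d ∈ Fintype.piFinset (fun ρ => (y ρ).divisors), muGlob μloc d = 1) ∧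
    ((¬ ∀ p : ℕ, p.Prime → ∀ i, ∃ ρ, (y ρ).factorization p < Λ i ρ) →
        ∑ d ∈ Fintype.piFinset (fun ρ => (y ρ).divisors), muGlob μloc d = 0) := by
  have hpos : ∀ i, ∃ ρ, 0 < Λ i ρ := by
    intro i
    by_contra! h
    have := hsum i
    simp [fun ρ => Nat.le_zero.mp (h ρ)] at this
  have h0 : μloc 0 = 1 := by
    have hIic : Finset.Iic (0 : S → ℕ) = {0} := by
      ext l
      simp only [Finset.mem_Iic, Finset.mem_singleton, funext_iff, Pi.le_def, Pi.zero_apply,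
        Nat.le_zero]
    rw [← if_pos (c := ∀ i, ∃ ρ, (0 : S → ℕ) ρ < Λ i ρ) (t := (1 : ℤ)) (e := 0) hpos, hμ 0, hIic,
      Finset.sum_singleton]
  have hy' : ∀ ρ, y ρ ≠ 0 := fun ρ => (hy ρ).ne'
  set P : Finset ℕ := Finset.univ.biUnion fun ρ => (y ρ).primeFactors with hPdef
  have hP : ∀ p ∈ P, p.Prime := by
    intro p hp
    obtain ⟨ρ, -, h⟩ := Finset.mem_biUnion.mp hp
    exact Nat.prime_of_mem_primeFactors h
  have hyP : ∀ ρ, (y ρ).primeFactors ⊆ P := fun ρ =>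
    Finset.subset_biUnion_of_mem (fun ρ => (y ρ).primeFactors) (Finset.mem_univ ρ)
  have hsum_eq : ∑ d ∈ Fintype.piFinset (fun ρ => (y ρ).divisors), muGlob μloc d =
      ∏ p : P, if ∀ i, ∃ ρ, (y ρ).factorization p < Λ i ρ then (1 : ℤ) else 0 := by
    simp only [fun p : P => hμ fun ρ => (y ρ).factorization p]
    rw [← sum_piFinset_divisors_prod μloc hP hy' hyP]
    refine Finset.sum_congr rfl fun d hd => muGlob_eq_prod h0 hP fun ρ => ?_
    have hdρ := Nat.dvd_of_mem_divisors (Fintype.mem_piFinset.mp hd ρ)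
    exact (Nat.primeFactors_mono hdρ (hy' ρ)).trans (hyP ρ)
  rw [hsum_eq]
  refine ⟨fun h => Finset.prod_eq_one fun p _ => if_pos (h p (hP p p.2)), fun h => ?_⟩
  push Not at h
  obtain ⟨p, -, i, hi⟩ := h
  obtain ⟨ρ, hρ⟩ := hpos i
  have hp : p ∈ P := hyP ρ (Finsupp.mem_support_iff.mpr (hρ.trans_le (hi ρ)).ne')
  refine Finset.prod_eq_zero (Finset.mem_univ ⟨p, hp⟩) (if_neg fun hX => ?_)
  obtain ⟨σ, hσ⟩ := hX i
  exact (hi σ).not_gt hσ
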